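/- Let d ≥ 1 and let λ be a partition of n ≥ 1. Then the class function on the symmetric group S_n whose value on permutations of cycle type μ is χ^{⊞^d(λ)}_{⊞^d(μ)} is a genuine character of S_n; that is, there exist nonnegative integers a_ν, one for each partition ν of n, such that for every partition μ of n one has χ^{⊞^d(λ)}_{⊞^d(μ)} = Σ_{ν ⊢ n} a_ν · χ^ν_μ. -/

import Mathlib

open MvPolynomial Finset

/-- The `r`-th power sum polynomial `p_r = x_1^r + ⋯ + x_N^r`. -/
noncomputable def psum (N r : ℕ) : MvPolynomial (Fin N) ℤ := ∑ i, X i ^ r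

/-- The power sum product `p_μ = p_{μ_1} ⋯ p_{μ_k}` for a partition `μ`. -/
noncomputable def pprod (N : ℕ) {n : ℕ} (mu : Nat.Partition n) : MvPolynomial (Fin N) ℤ :=
  (mu.parts.map (psum N)).prod

/-- The Vandermonde product `∏_{i<j} (x_i - x_j)`. -/
noncomputable def vandermonde (N : ℕ) : MvPolynomial (Fin N) ℤ :=
  ∏ p ∈ univ.filter (fun p : Fin N × Fin N => p.1 < p.2), (X p.1 - X p.2)

/-- The irreducible character value `χ^λ_μ` of `S_N`, via the Frobenius character formula:
the coefficient of `x_1^{λ_1 + N - 1} x_2^{λ_2 + N - 2} ⋯ x_N^{λ_N}` in `∏_{i<j}(x_i - x_j) ⋅ p_μ`,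
where `λ` is padded with trailing zeros to length `N`. -/
noncomputable def chi {N : ℕ} (l m : Nat.Partition N) : ℤ :=
  coeff (Finsupp.equivFunOnFinite.symm fun i : Fin N =>
    (l.parts.sort (· ≥ ·)).getD i 0 + (N - 1 - (i : ℕ))) (vandermonde N * pprod N m)

/-- `⊞^d(λ)`: replace each part `p` of `λ` by `d` copies of `d⋅p`; a partition of `d²n`. -/
def boxplus (d : ℕ) {n : ℕ} (P : Nat.Partition n) : Nat.Partition (d * (d * n)) where
  parts := P.parts.bind fun p => Multiset.replicate d (d * p)
  parts_pos := by
    intro i hi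
    simp only [Multiset.mem_bind, Multiset.mem_replicate] at hi
    obtain ⟨p, hp, hd, rfl⟩ := hi
    exact Nat.mul_pos (Nat.pos_of_ne_zero hd) (P.parts_pos hp)
  parts_sum := by
    rw [Multiset.sum_bind]
    simp only [Multiset.sum_replicate, smul_eq_mul]
    rw [Multiset.sum_map_mul_left, Multiset.sum_map_mul_left, Multiset.map_id', P.parts_sum]

set_option linter.unusedSectionVars false

section GroupCharacters

open LinearMap Module Representation

variable {G : Type*} [Group G]

/-- A rational function on `G` which is the character of a finite-dimensional
rational representation. -/
def IsCharacter (χ : G → ℚ) : Prop :=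
  ∃ (V : Type) (_ : AddCommGroup V) (_ : Module ℚ V) (_ : FiniteDimensional ℚ V)
    (ρ : Representation ℚ G V), χ = ρ.character

/-- A difference of two characters. -/
def IsVirtualCharacter (χ : G → ℚ) : Prop :=
  ∃ φ ψ : G → ℚ, IsCharacter φ ∧ IsCharacter ψ ∧ χ = φ - ψ

/-- The scalar product `|G|⁻¹ ∑ χ(g) ψ(g⁻¹)`. -/
noncomputable def charInner [Fintype G] (χ ψ : G → ℚ) : ℚ :=
  (Nat.card G : ℚ)⁻¹ * ∑ g, χ g * ψ g⁻¹

/-- An equivariant idempotent cuts out a representation. -/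
theorem exists_rep_of_idempotent {V : Type} [AddCommGroup V] [Module ℚ V] [FiniteDimensional ℚ V]
    (ρ : Representation ℚ G V) (e : V →ₗ[ℚ] V) (he : e ∘ₗ e = e)
    (hc : ∀ g, ρ g ∘ₗ e = e ∘ₗ ρ g) :
    ∃ σ : Representation ℚ G (range e), ∀ g, σ.character g = trace ℚ V (ρ g ∘ₗ e) := by
  have hle : ∀ g, range e ≤ (range e).comap (ρ g) := by
    rintro g _ ⟨v, rfl⟩
    exact ⟨ρ g v, (LinearMap.congr_fun (hc g) v).symm⟩
  refine ⟨ρ.subrepresentation (range e) hle, fun g => ?_⟩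
  have h1 : ρ g ∘ₗ e
      = ((range e).subtype ∘ₗ (ρ g).restrict (hle g)) ∘ₗ e.rangeRestrict := by
    ext v; rfl
  have h2 : e.rangeRestrict ∘ₗ ((range e).subtype ∘ₗ (ρ g).restrict (hle g))
      = (ρ g).restrict (hle g) := by
    ext ⟨_, v, rfl⟩
    change e (ρ g (e v)) = ρ g (e v)
    have := LinearMap.congr_fun (hc g) (e v)
    simp only [LinearMap.comp_apply] at this
    rw [← this]
    exact congrArg _ (LinearMap.congr_fun he v)
  rw [h1, trace_comp_comm', h2]
  rfl

theorem isCharacter_of_idempotent {V : Type} [AddCommGroup V] [Module ℚ V] [FiniteDimensional ℚ V]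
    (ρ : Representation ℚ G V) (e : V →ₗ[ℚ] V) (he : e ∘ₗ e = e)
    (hc : ∀ g, ρ g ∘ₗ e = e ∘ₗ ρ g) :
    IsCharacter fun g => trace ℚ V (ρ g ∘ₗ e) := by
  obtain ⟨σ, hσ⟩ := exists_rep_of_idempotent ρ e he hc
  exact ⟨_, _, _, inferInstance, σ, funext fun g => (hσ g).symm⟩

theorem IsCharacter.add {χ ψ : G → ℚ} (hχ : IsCharacter χ) (hψ : IsCharacter ψ) :
    IsCharacter (χ + ψ) := by
  obtain ⟨V, _, _, _, ρ, rfl⟩ := hχ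
  obtain ⟨W, _, _, _, σ, rfl⟩ := hψ
  exact ⟨V × W, _, _, inferInstance, ρ.prod σ, funext fun g => (trace_prodMap' _ _).symm⟩

theorem IsCharacter.mul {χ ψ : G → ℚ} (hχ : IsCharacter χ) (hψ : IsCharacter ψ) :
    IsCharacter (χ * ψ) := by
  obtain ⟨V, _, _, _, ρ, rfl⟩ := hχ
  obtain ⟨W, _, _, _, σ, rfl⟩ := hψ
  exact ⟨TensorProduct ℚ V W, _, _, inferInstance, ρ.tprod σ, (char_tensor ρ σ).symm⟩

theorem IsCharacter.comp {H : Type*} [Group H] {χ : G → ℚ} (hχ : IsCharacter χ) (f : H →* G) :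
    IsCharacter fun h => χ (f h) := by
  obtain ⟨V, _, _, _, ρ, rfl⟩ := hχ
  exact ⟨V, _, _, inferInstance, MonoidHom.comp ρ f, rfl⟩

theorem isCharacter_one : IsCharacter (1 : G → ℚ) :=
  ⟨ℚ, _, _, inferInstance, 1, funext fun g => by simp [character]⟩

theorem isCharacter_zero : IsCharacter (0 : G → ℚ) :=
  ⟨PUnit, _, _, inferInstance, 1, funext fun g => by
    simp [character, finrank_zero_of_subsingleton]⟩

theorem IsCharacter.prod {ι : Type*} {s : Finset ι} {χ : ι → G → ℚ}
    (h : ∀ i ∈ s, IsCharacter (χ i)) : IsCharacter (∏ i ∈ s, χ i) := by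
  classical
  induction s using Finset.induction_on with
  | empty => simpa using isCharacter_one
  | insert a s ha ih =>
    rw [Finset.prod_insert ha]
    exact (h a (by simp)).mul (ih fun i hi => h i (by simp [hi]))

theorem IsCharacter.isVirtual {χ : G → ℚ} (h : IsCharacter χ) : IsVirtualCharacter χ :=
  ⟨χ, 0, h, isCharacter_zero, by simp⟩

theorem IsVirtualCharacter.add {χ ψ : G → ℚ} (hχ : IsVirtualCharacter χ)
    (hψ : IsVirtualCharacter ψ) : IsVirtualCharacter (χ + ψ) := by
  obtain ⟨a, b, ha, hb, rfl⟩ := hχ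
  obtain ⟨c, d, hc, hd, rfl⟩ := hψ
  exact ⟨a + c, b + d, ha.add hc, hb.add hd, by ring⟩

theorem IsVirtualCharacter.neg {χ : G → ℚ} (hχ : IsVirtualCharacter χ) :
    IsVirtualCharacter (-χ) := by
  obtain ⟨a, b, ha, hb, rfl⟩ := hχ
  exact ⟨b, a, hb, ha, by ring⟩

theorem IsVirtualCharacter.sum {ι : Type*} {s : Finset ι} {χ : ι → G → ℚ}
    (h : ∀ i ∈ s, IsVirtualCharacter (χ i)) : IsVirtualCharacter (∑ i ∈ s, χ i) := by
  classical
  induction s using Finset.induction_on with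
  | empty => simpa using isCharacter_zero.isVirtual
  | insert a s ha ih =>
    rw [Finset.sum_insert ha]
    exact (h a (by simp)).add (ih fun i hi => h i (by simp [hi]))

theorem IsVirtualCharacter.zsmul {χ : G → ℚ} (hχ : IsVirtualCharacter χ) (n : ℤ) :
    IsVirtualCharacter (n • χ) := by
  induction n using Int.induction_on with
  | zero => simpa using isCharacter_zero.isVirtual
  | succ n ih => rw [add_smul, one_smul]; exact ih.add hχ
  | pred n ih => rw [sub_smul, one_smul, sub_eq_add_neg]; exact ih.add hχ.neg

section Finite

variable [Fintype G]

theorem charInner_sub_left (χ ψ φ : G → ℚ) :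
    charInner (χ - ψ) φ = charInner χ φ - charInner ψ φ := by
  simp [charInner, sub_mul, Finset.sum_sub_distrib, mul_sub]

theorem charInner_comm (χ ψ : G → ℚ) : charInner χ ψ = charInner ψ χ := by
  unfold charInner
  congr 1
  rw [← Equiv.sum_comp (Equiv.inv G)]
  exact Finset.sum_congr rfl fun g _ => by simp [mul_comm]

theorem charInner_character {V W : Type*} [AddCommGroup V] [Module ℚ V] [FiniteDimensional ℚ V]
    [AddCommGroup W] [Module ℚ W] [FiniteDimensional ℚ W]
    (ρ : Representation ℚ G V) (σ : Representation ℚ G W) :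
    charInner σ.character ρ.character = finrank ℚ (IntertwiningMap ρ σ) := by
  have : Invertible (Nat.card G : ℚ) := invertibleOfNonzero (by simp)
  exact card_inv_mul_sum_char_mul_char_eq_finrank ρ σ

theorem IsCharacter.exists_charInner_eq_nat {χ ψ : G → ℚ} (hχ : IsCharacter χ)
    (hψ : IsCharacter ψ) : ∃ n : ℕ, charInner χ ψ = n := by
  obtain ⟨V, _, _, _, ρ, rfl⟩ := hχ
  obtain ⟨W, _, _, _, σ, rfl⟩ := hψ
  exact ⟨_, charInner_character σ ρ⟩

theorem one_le_charInner_self {V : Type*} [AddCommGroup V] [Module ℚ V] [FiniteDimensional ℚ V]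
    (ρ : Representation ℚ G V) (hV : Nontrivial V) :
    1 ≤ charInner ρ.character ρ.character := by
  rw [charInner_character]
  have : Module.Finite ℚ (IntertwiningMap ρ ρ) :=
    Module.Finite.equiv (invariantsEquivIntertwiningMap ρ ρ)
  have : Nontrivial (IntertwiningMap ρ ρ) := by
    refine ⟨⟨IntertwiningMap.id ρ, 0, fun h => ?_⟩⟩
    obtain ⟨v, hv⟩ := exists_ne (0 : V)
    exact hv (DFunLike.congr_fun h v)
  exact_mod_cast finrank_pos (R := ℚ) (M := IntertwiningMap ρ ρ)

theorem exists_equivariant_pseudoinverse {V W : Type*} [AddCommGroup V] [Module ℚ V]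
    [AddCommGroup W] [Module ℚ W]
    (ρ : Representation ℚ G V) (σ : Representation ℚ G W) (θ : V →ₗ[ℚ] W)
    (hθ : ∀ g, θ ∘ₗ ρ g = σ g ∘ₗ θ) :
    ∃ ψ : W →ₗ[ℚ] V, (∀ g, ψ ∘ₗ σ g = ρ g ∘ₗ ψ) ∧ θ ∘ₗ ψ ∘ₗ θ = θ := by
  obtain ⟨s, hs⟩ := θ.rangeRestrict.exists_rightInverse_of_surjective (range_rangeRestrict θ)
  obtain ⟨p, hp⟩ := (range θ).subtype.exists_leftInverse_of_injective (by simp)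
  have hθ' : ∀ g v, θ (ρ g v) = σ g (θ v) := fun g v => LinearMap.congr_fun (hθ g) v
  have hψ : ∀ v, θ (s (p (θ v))) = θ v := fun v => by
    have h1 : p (θ v) = ⟨θ v, v, rfl⟩ := LinearMap.congr_fun hp ⟨θ v, v, rfl⟩
    have h2 := congrArg Subtype.val (LinearMap.congr_fun hs ⟨θ v, v, rfl⟩)
    rw [h1]
    exact h2
  set τ : W →ₗ[ℚ] V := s ∘ₗ p with hτ
  refine ⟨(Nat.card G : ℚ)⁻¹ • ∑ g : G, ρ g ∘ₗ τ ∘ₗ σ g⁻¹, fun h => ?_, ?_⟩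
  · ext v
    simp only [LinearMap.comp_apply, LinearMap.smul_apply, LinearMap.sum_apply, map_smul, map_sum]
    congr 1
    rw [← Equiv.sum_comp (Equiv.mulLeft h)]
    refine Finset.sum_congr rfl fun g _ => ?_
    simp
  · ext v
    have : ∀ g : G, θ (ρ g (τ (σ g⁻¹ (θ v)))) = θ v := fun g => by
      rw [hθ', ← hθ' g⁻¹, hτ, LinearMap.comp_apply, hψ, ← hθ', ← Module.End.mul_apply, ← map_mul]
      simp
    simp [map_sum, this, Finset.card_univ, ← Nat.card_eq_fintype_card,
      smul_smul, ← Nat.cast_smul_eq_nsmul ℚ]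

/-- A virtual character is a difference of two characters with no common constituent. -/
theorem exists_reps_sub_eq_of_charInner_zero (m : ℕ) {V W : Type} [AddCommGroup V] [Module ℚ V]
    [FiniteDimensional ℚ V] [AddCommGroup W] [Module ℚ W] [FiniteDimensional ℚ W]
    (ρ : Representation ℚ G V) (σ : Representation ℚ G W) (hm : finrank ℚ V ≤ m) :
    ∃ (V' W' : Type) (_ : AddCommGroup V') (_ : Module ℚ V') (_ : FiniteDimensional ℚ V')
      (_ : AddCommGroup W') (_ : Module ℚ W') (_ : FiniteDimensional ℚ W')
      (ρ' : Representation ℚ G V') (σ' : Representation ℚ G W'),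
      ρ.character - σ.character = ρ'.character - σ'.character ∧
        charInner σ'.character ρ'.character = 0 := by
  induction m generalizing V W with
  | zero =>
    refine ⟨V, W, _, _, inferInstance, _, _, inferInstance, ρ, σ, rfl, ?_⟩
    have : Subsingleton V := finrank_zero_iff.1 (Nat.le_zero.1 hm)
    rw [charInner_character]
    have : Subsingleton (IntertwiningMap ρ σ) :=
      ⟨fun a b => DFunLike.ext _ _ fun v => by simp [Subsingleton.elim v 0]⟩
    simp [finrank_zero_of_subsingleton]
  | succ m ih =>
    by_cases hss : Subsingleton (IntertwiningMap ρ σ)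
    · refine ⟨V, W, _, _, inferInstance, _, _, inferInstance, ρ, σ, rfl, ?_⟩
      rw [charInner_character, finrank_zero_of_subsingleton, Nat.cast_zero]
    rw [not_subsingleton_iff_nontrivial] at hss
    obtain ⟨θ, hθ⟩ := exists_ne (0 : IntertwiningMap ρ σ)
    obtain ⟨t, ht⟩ : ∃ t : V →ₗ[ℚ] W, t = θ.toLinearMap := ⟨_, rfl⟩
    have hcomm : ∀ g, t ∘ₗ ρ g = σ g ∘ₗ t := fun g => by
      ext v; subst ht; exact LinearMap.congr_fun (θ.isIntertwining' g) v
    have ht0 : t ≠ 0 := fun h => hθ (DFunLike.ext _ _ fun v => by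
      subst ht; exact LinearMap.congr_fun h v)
    obtain ⟨ψ, hψ, hreg⟩ := exists_equivariant_pseudoinverse ρ σ t hcomm
    have hid : ∀ v, t (ψ (t v)) = t v := fun v => LinearMap.congr_fun hreg v
    have hc' : ∀ g v, t (ρ g v) = σ g (t v) := fun g v => LinearMap.congr_fun (hcomm g) v
    have hp' : ∀ g v, ψ (σ g v) = ρ g (ψ v) := fun g v => LinearMap.congr_fun (hψ g) v
    obtain ⟨ρ', hρ'⟩ := exists_rep_of_idempotent ρ (LinearMap.id - ψ ∘ₗ t)
      (by ext v; simp [hid]) (fun g => by ext v; simp [hc', hp'])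
    obtain ⟨σ', hσ'⟩ := exists_rep_of_idempotent σ (LinearMap.id - t ∘ₗ ψ)
      (by ext v; simp [hid]) (fun g => by ext v; simp [hc', hp'])
    have hlt : finrank ℚ (range (LinearMap.id - ψ ∘ₗ t)) < finrank ℚ V := by
      refine Submodule.finrank_lt fun h => ht0 (LinearMap.ext fun v => ?_)
      obtain ⟨u, hu⟩ : v ∈ range (LinearMap.id - ψ ∘ₗ t) := h ▸ Submodule.mem_top
      rw [← hu]
      simp [hid]
    obtain ⟨V', W', _, _, _, _, _, _, ρ₂, σ₂, h1, h2⟩ := ih ρ' σ' (by omega)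
    refine ⟨V', W', _, _, inferInstance, _, _, inferInstance, ρ₂, σ₂, ?_, h2⟩
    rw [← h1]
    funext g
    have key : trace ℚ V (ρ g ∘ₗ ψ ∘ₗ t) = trace ℚ W (σ g ∘ₗ t ∘ₗ ψ) := by
      rw [← LinearMap.comp_assoc, trace_comp_comm', ← LinearMap.comp_assoc, hcomm,
        LinearMap.comp_assoc]
    rw [Pi.sub_apply, Pi.sub_apply, hρ', hσ', LinearMap.comp_sub, LinearMap.comp_sub, map_sub,
      map_sub, key, LinearMap.comp_id, LinearMap.comp_id, character, character]
    ring

theorem IsVirtualCharacter.exists_disjoint {χ : G → ℚ} (hχ : IsVirtualCharacter χ) :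
    ∃ φ ψ : G → ℚ, IsCharacter φ ∧ IsCharacter ψ ∧ χ = φ - ψ ∧ charInner ψ φ = 0 := by
  obtain ⟨_, _, ⟨V, _, _, _, ρ, rfl⟩, ⟨W, _, _, _, σ, rfl⟩, rfl⟩ := hχ
  obtain ⟨V', W', _, _, _, _, _, _, ρ', σ', h1, h2⟩ :=
    exists_reps_sub_eq_of_charInner_zero _ ρ σ le_rfl
  exact ⟨_, _, ⟨V', _, _, inferInstance, ρ', rfl⟩, ⟨W', _, _, inferInstance, σ', rfl⟩, h1, h2⟩

theorem IsCharacter.eq_zero_or_one_le {χ : G → ℚ} (hχ : IsCharacter χ) :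
    χ = 0 ∨ (1 ≤ charInner χ χ ∧ 0 < χ 1) := by
  obtain ⟨V, _, _, _, ρ, rfl⟩ := hχ
  rcases subsingleton_or_nontrivial V with h | h
  · left
    funext g
    simp [character, Subsingleton.elim (ρ g) 0]
  · right
    exact ⟨one_le_charInner_self ρ h, by rw [char_one]; exact_mod_cast finrank_pos⟩

/-- A virtual character pairing nonnegatively with every character is a character. -/
theorem IsVirtualCharacter.isCharacter_of_charInner_nonneg {χ : G → ℚ}
    (hχ : IsVirtualCharacter χ) (h : ∀ ψ, IsCharacter ψ → 0 ≤ charInner χ ψ) :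
    IsCharacter χ := by
  obtain ⟨φ, ψ, hφ, hψ, rfl, h0⟩ := hχ.exists_disjoint
  rcases hψ.eq_zero_or_one_le with rfl | ⟨h1, -⟩
  · simpa using hφ
  · have := h ψ hψ
    rw [charInner_sub_left, charInner_comm, h0] at this
    linarith

/-- A virtual character of norm at most one and nonnegative degree is a character. -/
theorem IsVirtualCharacter.isCharacter_of_charInner_self_le_one {χ : G → ℚ}
    (hχ : IsVirtualCharacter χ) (h : charInner χ χ ≤ 1) (h1 : 0 ≤ χ 1) : IsCharacter χ := by
  obtain ⟨φ, ψ, hφ, hψ, rfl, h0⟩ := hχ.exists_disjoint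
  rcases hψ.eq_zero_or_one_le with rfl | ⟨h2, h3⟩
  · simpa using hφ
  rcases hφ.eq_zero_or_one_le with rfl | ⟨h4, h5⟩
  · simp only [Pi.sub_apply, Pi.zero_apply] at h1
    linarith
  · have e : charInner (φ - ψ) (φ - ψ) = charInner φ φ + charInner ψ ψ := by
      rw [charInner_sub_left, charInner_comm φ, charInner_comm ψ, charInner_sub_left,
        charInner_sub_left, charInner_comm φ ψ, h0]
      ring
    linarith

end Finite

end GroupCharacters

section Colorings

open LinearMap

variable {Y ι κ : Type} [Fintype Y] [DecidableEq Y] [Fintype ι] [DecidableEq ι]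
  [Fintype κ] [DecidableEq κ]

/-- The number of times each color is used by a coloring. -/
def content (f : Y → ι) (i : ι) : ℕ := #{y | f y = i}

theorem sum_content (f : Y → ι) : ∑ i, content f i = Fintype.card Y := by
  simp only [content]
  rw [← card_eq_sum_card_fiberwise (fun _ _ => Finset.mem_coe.2 (mem_univ _))]
  rfl

theorem content_comp_perm (f : Y → ι) (g : Equiv.Perm Y) : content (f ∘ g) = content f := by
  funext i
  simp only [content]
  exact card_bij (fun y _ => g y) (by simp) (by simp) fun y hy => ⟨g.symm y, by simpa using hy⟩

/-- The sum of a weight of the content over the `g`-invariant colorings. -/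
def colorSum (k : (ι → ℕ) → ℤ) (g : Equiv.Perm Y) : ℤ :=
  ∑ f : Y → ι with f ∘ g = f, k (content f)

theorem comp_inv_eq_iff (f : Y → ι) (g : Equiv.Perm Y) : f ∘ ⇑g⁻¹ = f ↔ f ∘ g = f := by
  constructor <;> intro h
  · conv_lhs => rw [← h]
    ext y; simp
  · conv_lhs => rw [← h]
    ext y; simp

theorem colorSum_inv (k : (ι → ℕ) → ℤ) (g : Equiv.Perm Y) : colorSum k g⁻¹ = colorSum k g := by
  simp only [colorSum, comp_inv_eq_iff]

variable (Y ι) in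
/-- The permutation representation on rational functions of colorings. -/
def coloringRep : Representation ℚ (Equiv.Perm Y) ((Y → ι) → ℚ) where
  toFun g := LinearMap.funLeft ℚ ℚ fun f : Y → ι => f ∘ g
  map_one' := rfl
  map_mul' _ _ := rfl

theorem isVirtualCharacter_colorSum (k : (ι → ℕ) → ℤ) :
    IsVirtualCharacter fun g : Equiv.Perm Y => (colorSum k g : ℚ) := by
  classical
  let e (c : ι → ℕ) : ((Y → ι) → ℚ) →ₗ[ℚ] ((Y → ι) → ℚ) :=
    LinearMap.pi fun f => if content f = c then LinearMap.proj f else 0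
  have he (c v f) : e c v f = if content f = c then v f else 0 := by
    simp only [e, LinearMap.pi_apply]; split_ifs <;> rfl
  have hchar (c : ι → ℕ) := isCharacter_of_idempotent (coloringRep Y ι) (e c)
    (LinearMap.ext fun v => funext fun f => by
      simp only [LinearMap.comp_apply, he]; split_ifs <;> rfl)
    (fun g => LinearMap.ext fun v => funext fun f => by
      simp only [LinearMap.comp_apply, he]
      change e c v (f ∘ g) = if content f = c then v (f ∘ g) else 0
      rw [he, content_comp_perm])
  have htrace (c : ι → ℕ) (g : Equiv.Perm Y) : trace ℚ _ (coloringRep Y ι g ∘ₗ e c)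
      = ∑ f : Y → ι with f ∘ g = f, if content f = c then 1 else 0 := by
    rw [trace_eq_matrix_trace ℚ (Pi.basisFun ℚ (Y → ι)), Matrix.trace, sum_filter]
    refine Finset.sum_congr rfl fun f _ => ?_
    rw [Matrix.diag_apply, toMatrix_apply, Pi.basisFun_repr, Pi.basisFun_apply]
    change e c (Pi.single f 1) (f ∘ g) = _
    rw [he, content_comp_perm, Pi.single_apply]
    split_ifs <;> rfl
  have := IsVirtualCharacter.sum (s := univ.image (content (Y := Y) (ι := ι)))
    fun c _ => (hchar c).isVirtual.zsmul (k c)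
  convert this using 1
  funext g
  simp only [Finset.sum_apply, Pi.smul_apply, htrace, colorSum, Int.cast_sum, smul_sum]
  rw [sum_comm]
  refine Finset.sum_congr rfl fun f _ => ?_
  rw [Finset.sum_eq_single (content f)]
  · simp
  · intro c _ hc
    simp [hc.symm]
  · simp

/-- The permutations acting within the fibers of `φ`. -/
def fiberPermHom (φ : Y → κ) : (∀ r, Equiv.Perm {y // φ y = r}) →* Equiv.Perm Y :=
  (Equiv.permCongrHom (Equiv.sigmaFiberEquiv φ)).toMonoidHom.comp
    (Equiv.Perm.sigmaCongrRightHom fun r => {y // φ y = r})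

theorem fiberPermHom_apply (φ : Y → κ) (p : ∀ r, Equiv.Perm {y // φ y = r}) (y : Y) :
    fiberPermHom φ p y = (p (φ y) ⟨y, rfl⟩).1 := rfl

theorem fiberPermHom_apply_coe (φ : Y → κ) (p : ∀ r, Equiv.Perm {y // φ y = r}) (r : κ)
    (y : {y // φ y = r}) : fiberPermHom φ p y = (p r y).1 := by
  obtain ⟨y, rfl⟩ := y
  rfl

theorem sum_stabilizer_eq_sum_fiberPerm (φ : Y → κ) (T : Equiv.Perm Y → ℚ) :
    ∑ h ∈ univ.filter (fun h : Equiv.Perm Y => φ ∘ h = φ), T h = ∑ p, T (fiberPermHom φ p) := by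
  symm
  refine sum_bij (fun p _ => fiberPermHom φ p) ?_ ?_ ?_ ?_
  · intro p _
    simp only [mem_filter, mem_univ, true_and]
    funext y
    exact (p (φ y) ⟨y, rfl⟩).2
  · intro p _ q _ h
    funext r
    ext y
    rw [← fiberPermHom_apply_coe, ← fiberPermHom_apply_coe, h]
  · intro h hh
    simp only [mem_filter, mem_univ, true_and] at hh
    refine ⟨fun r => h.subtypePerm fun y => ?_, mem_univ _, ?_⟩
    · rw [← Function.comp_apply (f := φ), hh]
    · ext y; rfl
  · intro _ _; rfl

theorem sum_invariant_prod_eq_prod_colorSum (k : (ι → ℕ) → ℤ) (φ : Y → κ)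
    (p : ∀ r, Equiv.Perm {y // φ y = r}) :
    ∑ ψ : Y → ι with ψ ∘ fiberPermHom φ p = ψ, ∏ r, k (fun i => #{y | ψ y = i ∧ φ y = r})
      = ∏ r, colorSum k (p r) := by
  simp only [colorSum]
  rw [prod_univ_sum]
  refine sum_bij' (fun ψ _ r y => ψ y) (fun F _ y => F (φ y) ⟨y, rfl⟩) ?_ ?_ ?_ ?_ ?_
  · intro ψ hψ
    simp only [mem_filter, mem_univ, true_and, Fintype.mem_piFinset] at hψ ⊢
    intro r
    funext y
    simp only [Function.comp_apply]
    rw [← fiberPermHom_apply_coe, ← Function.comp_apply (f := ψ), hψ]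
  · intro F hF
    simp only [mem_filter, mem_univ, true_and, Fintype.mem_piFinset] at hF ⊢
    have key : ∀ r (y : {y // φ y = r}), F (φ y.1) ⟨y.1, rfl⟩ = F r y := by
      rintro r ⟨y, rfl⟩; rfl
    funext y
    simp only [Function.comp_apply, fiberPermHom_apply]
    rw [key]
    exact congrFun (hF (φ y)) ⟨y, rfl⟩
  · intro _ _; rfl
  · intro F _
    funext r y
    obtain ⟨y, rfl⟩ := y
    rfl
  · intro ψ _
    refine Finset.prod_congr rfl fun r _ => congrArg k (funext fun i => ?_)
    simp only [content]
    refine (card_bij (fun y _ => y.1) ?_ ?_ ?_).symm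
    · rintro ⟨y, hy⟩ h; simpa [hy] using h
    · intro a _ b _ h; exact Subtype.ext h
    · intro y hy
      simp only [mem_filter, mem_univ, true_and] at hy
      exact ⟨⟨y, hy.2⟩, by simpa using hy.1, rfl⟩

/-- If the weight `k` gives characters of all symmetric groups, then so does the corresponding
product weight on pairs of colors. -/
theorem isCharacter_colorSum_prod (k : (ι → ℕ) → ℤ)
    (hk : ∀ (Z : Type) [Fintype Z] [DecidableEq Z],
      IsCharacter fun g : Equiv.Perm Z => (colorSum k g : ℚ)) :
    IsCharacter fun g : Equiv.Perm Y =>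
      (colorSum (fun c : ι × κ → ℕ => ∏ r, k fun i => c (i, r)) g : ℚ) := by
  refine (isVirtualCharacter_colorSum _).isCharacter_of_charInner_nonneg fun χ hχ => ?_
  refine mul_nonneg (by positivity) ?_
  have hsplit (h : Equiv.Perm Y) :
      (colorSum (fun c : ι × κ → ℕ => ∏ r, k fun i => c (i, r)) h : ℚ)
        = ∑ φ : Y → κ with φ ∘ h = φ, ∑ ψ : Y → ι with ψ ∘ h = ψ,
          ((∏ r, k fun i => #{y | ψ y = i ∧ φ y = r} : ℤ) : ℚ) := by
    rw [colorSum, Int.cast_sum, ← Finset.sum_product']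
    refine sum_bij' (fun F _ => (Prod.snd ∘ F, Prod.fst ∘ F)) (fun p _ y => (p.2 y, p.1 y))
      ?_ ?_ ?_ ?_ ?_
    · intro F hF
      simp only [mem_filter, mem_univ, true_and, mem_product] at hF ⊢
      exact ⟨by rw [Function.comp_assoc, hF], by rw [Function.comp_assoc, hF]⟩
    · rintro ⟨φ, ψ⟩ hF
      simp only [mem_filter, mem_univ, true_and, mem_product] at hF ⊢
      funext y
      exact Prod.ext (congrFun hF.2 y) (congrFun hF.1 y)
    · intro _ _; rfl
    · intro _ _; rfl
    · intro F _
      simp [content, Prod.ext_iff]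
  simp_rw [hsplit, sum_mul, sum_filter]
  rw [sum_comm]
  refine sum_nonneg fun φ _ => ?_
  rw [← sum_filter]
  simp_rw [← sum_filter, ← sum_mul]
  rw [sum_stabilizer_eq_sum_fiberPerm φ fun h =>
    (∑ ψ : Y → ι with ψ ∘ h = ψ, ((∏ r, k fun i => #{y | ψ y = i ∧ φ y = r} : ℤ) : ℚ)) * χ h⁻¹]
  have hr (r : κ) : IsCharacter fun p : ∀ r, Equiv.Perm {y // φ y = r} =>
      (colorSum k (p r) : ℚ) :=
    (hk {y // φ y = r}).comp (Pi.evalMonoidHom (fun r => Equiv.Perm {y // φ y = r}) r)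
  have h1 : IsCharacter fun p : ∀ r, Equiv.Perm {y // φ y = r} =>
      (∏ r, colorSum k (p r) : ℚ) := by
    have h0 := IsCharacter.prod (s := univ) fun r _ => hr r
    rwa [show (∏ r, fun p : ∀ r, Equiv.Perm {y // φ y = r} => (colorSum k (p r) : ℚ)) =
      fun p => ∏ r, (colorSum k (p r) : ℚ) from funext fun p => Finset.prod_apply _ _ _] at h0
  obtain ⟨n, hn⟩ := h1.exists_charInner_eq_nat (hχ.comp (fiberPermHom φ))
  have h2 := Nat.cast_nonneg (α := ℚ) n
  rw [← hn, charInner, mul_nonneg_iff_of_pos_left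
    (inv_pos.2 (Nat.cast_pos.2 Nat.card_pos))] at h2
  convert h2 using 3 with p
  · rw [← Int.cast_sum, sum_invariant_prod_eq_prod_colorSum, Int.cast_prod]
  · rw [map_inv]

end Colorings

section Burnside

open Nat

variable {Y ι ι' : Type} [Fintype Y] [DecidableEq Y] [Fintype ι] [DecidableEq ι]
  [Fintype ι'] [DecidableEq ι']

theorem card_colorings_content (m : ι → ℕ) (hm : ∑ i, m i = Fintype.card Y) :
    #{f : Y → ι | content f = m} = Nat.multinomial univ m := by
  have h : (∑ i : ι, (X i : MvPolynomial ι ℕ)) ^ Fintype.card Y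
      = ∑ f : Y → ι, monomial (Finsupp.equivFunOnFinite.symm (content f)) 1 := by
    rw [← Finset.card_univ, ← Finset.prod_const, Finset.prod_univ_sum]
    simp only [Fintype.piFinset_univ]
    refine Finset.sum_congr rfl fun f _ => ?_
    rw [← Finset.prod_fiberwise univ f, monomial_eq]
    simp only [C_1, one_mul]
    rw [Finsupp.prod_fintype _ _ (by simp)]
    refine Finset.prod_congr rfl fun i _ => ?_
    rw [Finset.prod_congr rfl (g := fun _ => X i) (by simp), Finset.prod_const]
    rfl
  have h2 : coeff (Finsupp.equivFunOnFinite.symm m)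
      ((∑ i : ι, (X i : MvPolynomial ι ℕ)) ^ Fintype.card Y) = Nat.multinomial univ m := by
    rw [Finset.sum_pow_eq_sum_piAntidiag, coeff_sum, Finset.sum_eq_single m]
    · rw [← map_natCast C, coeff_C_mul, show ∏ i, X i ^ m i =
        (monomial (Finsupp.equivFunOnFinite.symm m) 1 : MvPolynomial ι ℕ) by
          rw [monomial_eq, Finsupp.prod_fintype _ _ (by simp)]; simp]
      simp
    · intro k _ hk
      rw [← map_natCast C, coeff_C_mul, show ∏ i, X i ^ k i =
        (monomial (Finsupp.equivFunOnFinite.symm k) 1 : MvPolynomial ι ℕ) by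
          rw [monomial_eq, Finsupp.prod_fintype _ _ (by simp)]; simp]
      simp [coeff_monomial, hk]
    · simp [hm]
  rw [← h2, h, coeff_sum, Finset.card_filter]
  simp [coeff_monomial]

theorem card_perm_comp_eq (f : Y → ι) :
    #{g : Equiv.Perm Y | f ∘ g = f} = ∏ i, (content f i)! := by
  rw [← Fintype.card_subtype, DomMulAct.stabilizer_card]
  simp [content, Fintype.card_subtype]

theorem sum_colorings_mul_factorial (Φ : (ι → ℕ) → ℤ) :
    ∑ f : Y → ι, Φ (content f) * (∏ i, (content f i)! : ℕ)
      = (Fintype.card Y)! * ∑ m ∈ piAntidiag univ (Fintype.card Y), Φ m := by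
  rw [← Finset.sum_fiberwise_of_maps_to (g := content)
    (t := piAntidiag univ (Fintype.card Y)) (by simp [sum_content]), mul_sum]
  refine Finset.sum_congr rfl fun m hm => ?_
  simp only [mem_piAntidiag, mem_univ, implies_true, and_true] at hm
  rw [Finset.sum_congr rfl (g := fun _ => Φ m * (∏ i, (m i)! : ℕ))
    (by intro f hf; rw [(mem_filter.1 hf).2]), Finset.sum_const, card_colorings_content m hm,
    nsmul_eq_mul, ← hm, ← Nat.multinomial_spec]
  push_cast
  ring

theorem sum_colorSum_mul_colorSum (k : (ι → ℕ) → ℤ) (k' : (ι' → ℕ) → ℤ) :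
    ∑ g : Equiv.Perm Y, colorSum k g * colorSum k' g
      = (Fintype.card Y)! * ∑ m ∈ piAntidiag univ (Fintype.card Y),
        k (fun i => ∑ j, m (i, j)) * k' (fun j => ∑ i, m (i, j)) := by
  rw [← sum_colorings_mul_factorial fun m : ι × ι' → ℕ =>
    k (fun i => ∑ j, m (i, j)) * k' (fun j => ∑ i, m (i, j))]
  simp only [colorSum, ← card_perm_comp_eq, card_filter, Finset.sum_mul_sum, sum_filter]
  push_cast
  simp only [mul_sum]
  rw [sum_comm (s := univ (α := Y → ι × ι'))]
  refine Finset.sum_congr rfl fun g _ => ?_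
  rw [← (Equiv.arrowProdEquivProdArrow Y (fun _ => ι) fun _ => ι').symm.sum_comp,
    Fintype.sum_prod_type]
  refine Finset.sum_congr rfl fun f _ => ?_
  by_cases hf : f ∘ g = f
  · simp only [hf, if_true]
    refine Finset.sum_congr rfl fun f' _ => ?_
    have h1 : (fun i => ∑ j, content (fun y => (f y, f' y)) (i, j)) = content f := by
      funext i
      simp only [content, Prod.mk.injEq]
      rw [card_eq_sum_card_fiberwise (f := f') (t := univ) (by simp)]
      simp [filter_filter]
    have h2 : (fun j => ∑ i, content (fun y => (f y, f' y)) (i, j)) = content f' := by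
      funext i
      simp only [content, Prod.mk.injEq]
      rw [card_eq_sum_card_fiberwise (f := f) (t := univ) (by simp)]
      simp [filter_filter, and_comm]
    change _ = (k (fun i => ∑ j, content (fun y => (f y, f' y)) (i, j)) *
      k' fun j => ∑ i, content (fun y => (f y, f' y)) (i, j)) *
      if (fun y => (f y, f' y)) ∘ g = (fun y => (f y, f' y)) then 1 else 0
    rw [h1, h2]
    by_cases hf' : f' ∘ g = f'
    · rw [if_pos hf', if_pos]
      · simp
      · funext y; exact Prod.ext (congrFun hf y) (congrFun hf' y)
    · rw [if_neg hf', if_neg]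
      · simp
      · intro h; exact hf' (funext fun y => congrArg Prod.snd (congrFun h y))
  · simp only [hf, if_false, zero_mul, sum_const_zero]
    symm
    refine Finset.sum_eq_zero fun f' _ => ?_
    rw [if_neg, mul_zero]
    intro h; exact hf (funext fun y => congrArg Prod.fst (congrFun h y))

end Burnside

section Cauchy

theorem exists_matrix_prod_one_sub {A : Type*} [CommRing A] {M : ℕ} (x : Fin M → A) :
    ∃ q : Matrix (Fin M) (Fin M) A, ∀ y : Fin M → A,
      Matrix.of (fun i j => ∏ k ∈ univ.erase i, (1 - x k * y j))
        = q * (Matrix.vandermonde y).transpose := by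
  let Q (i : Fin M) : Polynomial A :=
    ∏ k ∈ univ.erase i, (1 - Polynomial.C (x k) * Polynomial.X)
  have hQ (i : Fin M) : (Q i).natDegree < M := by
    refine (Polynomial.natDegree_prod_le _ _).trans_lt ?_
    refine (Finset.sum_le_card_nsmul _ _ 1 fun k _ => ?_).trans_lt ?_
    · refine (Polynomial.natDegree_sub_le _ _).trans ?_
      simpa using (Polynomial.natDegree_C_mul_X_pow_le (x k) 1)
    · rw [card_erase_of_mem (mem_univ _), card_univ, Fintype.card_fin, smul_eq_mul, mul_one]
      have := i.pos
      omega
  refine ⟨Matrix.of fun i m => (Q i).coeff m, fun y => ?_⟩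
  ext i j
  simp only [Matrix.of_apply, Matrix.mul_apply, Matrix.transpose_apply, Matrix.vandermonde_apply]
  rw [Fin.sum_univ_eq_sum_range fun m => (Q i).coeff m * y j ^ m,
    ← Polynomial.eval_eq_sum_range' (hQ i)]
  simp [Q, Polynomial.eval_prod]

theorem prod_prod_erase_eq {A : Type*} [CommMonoid A] {M : ℕ} (f : Fin M → Fin M → A) :
    ∏ i, ∏ k ∈ univ.erase i, f i k = ∏ i, ∏ j ∈ Ioi i, (f i j * f j i) := by
  have h (i : Fin M) : univ.erase i = Iio i ∪ Ioi i := by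
    ext; simp [lt_or_lt_iff_ne]
  simp only [h, Finset.prod_mul_distrib]
  rw [Finset.prod_congr rfl fun i _ => Finset.prod_union
    (Finset.disjoint_left.2 fun a ha hb => lt_asymm (mem_Iio.1 ha) (mem_Ioi.1 hb)),
    Finset.prod_mul_distrib, mul_comm]
  congr 1
  exact Finset.prod_comm' (by simp)

/-- The numerator of the Cauchy determinant. -/
theorem det_prod_one_sub_of_field {K : Type*} [Field K] {M : ℕ} (x y : Fin M → K)
    (hx0 : ∀ i, x i ≠ 0) (hx : Function.Injective x) :
    (Matrix.of fun i j => ∏ k ∈ univ.erase i, (1 - x k * y j)).det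
      = (Matrix.vandermonde x).det * (Matrix.vandermonde y).det := by
  obtain ⟨q, hq⟩ := exists_matrix_prod_one_sub x
  rw [hq y, Matrix.det_mul, Matrix.det_transpose]
  congr 1
  have h := congrArg Matrix.det (hq fun j => (x j)⁻¹)
  rw [Matrix.det_mul, Matrix.det_transpose, show Matrix.of (fun i j => ∏ k ∈ univ.erase i,
    (1 - x k * (x j)⁻¹)) = Matrix.diagonal fun i => ∏ k ∈ univ.erase i, (1 - x k * (x i)⁻¹) by
      ext i j
      by_cases hij : i = j
      · subst hij; simp
      · rw [Matrix.diagonal_apply_ne _ hij, Matrix.of_apply]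
        exact prod_eq_zero (mem_erase.2 ⟨Ne.symm hij, mem_univ _⟩) (by simp [hx0])] at h
  have h0 : (Matrix.vandermonde fun j => (x j)⁻¹).det ≠ 0 :=
    Matrix.det_vandermonde_ne_zero_iff.2 fun a b hab => hx (inv_injective hab)
  refine mul_right_cancel₀ h0 (h.symm.trans ?_)
  rw [Matrix.det_diagonal, prod_prod_erase_eq (fun i k => 1 - x k * (x i)⁻¹),
    Matrix.det_vandermonde, Matrix.det_vandermonde, ← prod_mul_distrib]
  refine Finset.prod_congr rfl fun i _ => ?_
  rw [← prod_mul_distrib]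
  refine Finset.prod_congr rfl fun j _ => ?_
  field_simp [hx0 i, hx0 j]

theorem det_prod_one_sub {A : Type*} [CommRing A] [IsDomain A] {M : ℕ} (x y : Fin M → A)
    (hx0 : ∀ i, x i ≠ 0) (hx : Function.Injective x) :
    (Matrix.of fun i j => ∏ k ∈ univ.erase i, (1 - x k * y j)).det
      = (Matrix.vandermonde x).det * (Matrix.vandermonde y).det := by
  have hinj := IsFractionRing.injective A (FractionRing A)
  refine hinj ?_
  have h := det_prod_one_sub_of_field (fun i => algebraMap A (FractionRing A) (x i))
    (fun i => algebraMap A (FractionRing A) (y i))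
    (fun i => by simpa using hx0 i) (hinj.comp hx)
  rw [map_mul, RingHom.map_det, RingHom.map_det, RingHom.map_det]
  refine (congrArg Matrix.det ?_).trans (h.trans (congrArg₂ _ (congrArg Matrix.det ?_)
    (congrArg Matrix.det ?_))) <;> ext i j <;> simp

theorem det_of_mul_eq_one {A : Type*} [CommRing A] [IsDomain A] {M : ℕ} (x y : Fin M → A)
    (hx0 : ∀ i, x i ≠ 0) (hx : Function.Injective x) (G : Fin M → Fin M → A)
    (hG : ∀ i j, (1 - x i * y j) * G i j = 1) :
    (Matrix.of G).det
      = (Matrix.vandermonde x).det * (Matrix.vandermonde y).det *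
        ∏ p : Fin M × Fin M, G p.1 p.2 := by
  rw [← det_prod_one_sub x y hx0 hx, Fintype.prod_prod_type_right, mul_comm,
    ← Matrix.det_mul_row]
  congr 1
  ext i j
  simp only [Matrix.of_apply]
  rw [← mul_prod_erase univ _ (mem_univ i), mul_assoc, ← prod_mul_distrib,
    prod_eq_one fun k _ => by rw [mul_comm, hG], mul_one]

end Cauchy

section Orthogonality

variable {ι : Type} [Fintype ι] [DecidableEq ι]

/-- The coefficient of `x ^ β` in the product of `x ^ c` and the alternant `det (x_i ^ δ_j)`. -/
def alternantCoeff (δ β c : ι → ℕ) : ℤ :=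
  (Matrix.of fun i j => if c i + δ j = β i then (1 : ℤ) else 0).det

theorem prod_X_pow_eq {A : Type*} [CommRing A] (c : ι → ℕ) :
    ∏ i, (X i : MvPolynomial ι A) ^ c i = monomial (Finsupp.equivFunOnFinite.symm c) 1 := by
  rw [monomial_eq, Finsupp.prod_fintype _ _ (by simp)]
  simp

theorem coeff_prod_X_pow_perm {A : Type*} [CommRing A] (β c : ι → ℕ) (σ : Equiv.Perm ι) :
    coeff (Finsupp.equivFunOnFinite.symm β) (∏ i, (X (σ i) : MvPolynomial ι A) ^ c i)
      = if ∀ i, c i = β (σ i) then 1 else 0 := by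
  rw [← Equiv.prod_comp σ.symm]
  simp only [Equiv.apply_symm_apply]
  rw [prod_X_pow_eq fun i => c (σ.symm i), coeff_monomial]
  refine if_congr (Equiv.apply_eq_iff_eq _ |>.trans ⟨fun h i => ?_, fun h => funext fun i => ?_⟩)
    rfl rfl
  · simpa using congrFun h (σ i)
  · simpa using h (σ.symm i)

theorem coeff_det_mul_prod {A : Type*} [CommRing A] (δ β c : ι → ℕ) :
    coeff (Finsupp.equivFunOnFinite.symm β)
      ((Matrix.of fun i j => (X i : MvPolynomial ι A) ^ δ j).det * ∏ i, X i ^ c i)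
      = (alternantCoeff δ β c : A) := by
  rw [mul_comm, ← Matrix.det_mul_column, Matrix.det_apply, coeff_sum, alternantCoeff,
    Matrix.det_apply, Int.cast_sum]
  refine Finset.sum_congr rfl fun σ _ => ?_
  simp only [Matrix.of_apply, Units.smul_def, zsmul_eq_mul, ← pow_add, Int.cast_mul, Int.cast_prod]
  rw [← map_intCast (C : A →+* MvPolynomial ι A), coeff_C_mul,
    coeff_prod_X_pow_perm β (fun i => c (σ i) + δ i) σ]
  simp [Finset.prod_ite_zero]

theorem alternantCoeff_perm (δ β c : ι → ℕ) (σ : Equiv.Perm ι) :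
    alternantCoeff (δ ∘ σ) β c = Equiv.Perm.sign σ * alternantCoeff δ β c := by
  have h := Matrix.det_permute' σ (Matrix.of fun i j => if c i + δ j = β i then (1 : ℤ) else 0)
  exact h

theorem cauchy_identity_coeff (M n : ℕ) :
    (∑ σ : Equiv.Perm (Fin M), (Equiv.Perm.sign σ : ℤ) •
      ∑ l ∈ piAntidiag univ (n + ∑ i : Fin M, (i : ℕ)),
        ∏ i, ((X (σ i) * C (X i) : MvPolynomial (Fin M) (MvPolynomial (Fin M) ℤ))) ^ l i)
    = (Matrix.vandermonde fun i => (X i : MvPolynomial (Fin M) (MvPolynomial (Fin M) ℤ))).det *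
        C (Matrix.vandermonde fun i => (X i : MvPolynomial (Fin M) ℤ)).det *
      ∑ m ∈ piAntidiag univ n, ∏ p : Fin M × Fin M, (X p.1 * C (X p.2)) ^ m p := by
  let R := MvPolynomial (Fin M) (MvPolynomial (Fin M) ℤ)
  let x (i : Fin M) : PowerSeries R := PowerSeries.X * PowerSeries.C (X i)
  let y (i : Fin M) : PowerSeries R := PowerSeries.C (C (X i))
  let G (i j : Fin M) : PowerSeries R := PowerSeries.mk fun m => (X i * C (X j)) ^ m
  have hG (i j : Fin M) : (1 - x i * y j) * G i j = 1 := by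
    ext m
    rw [sub_mul, one_mul, map_sub, show x i * y j * G i j
      = PowerSeries.C (X i * C (X j)) * (PowerSeries.X * G i j) by simp [x, y]; ring,
      PowerSeries.coeff_C_mul]
    cases m with
    | zero => simp [G]
    | succ m => simp [G, PowerSeries.coeff_succ_X_mul, PowerSeries.coeff_one, pow_succ']
  have hx : Function.Injective x := by
    intro i j h
    have := PowerSeries.C_injective (mul_left_cancel₀ PowerSeries.X_ne_zero h)
    exact X_injective this
  have hx0 (i : Fin M) : x i ≠ 0 :=
    mul_ne_zero PowerSeries.X_ne_zero fun h =>
      X_ne_zero i (PowerSeries.C_injective (h.trans (map_zero _).symm))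
  have h := det_of_mul_eq_one x y hx0 hx G hG
  have hVx : (Matrix.vandermonde x).det
      = PowerSeries.X ^ (∑ i : Fin M, (i : ℕ)) *
        PowerSeries.C (Matrix.vandermonde fun i => X i).det := by
    rw [RingHom.map_det, ← prod_pow_eq_pow_sum, ← Matrix.det_mul_row]
    congr 1
    ext i j : 2
    simp [x, Matrix.vandermonde_apply, mul_pow]
  have hVy : (Matrix.vandermonde y).det =
      PowerSeries.C (C (Matrix.vandermonde fun i => X i).det) := by
    rw [RingHom.map_det, RingHom.map_det]
    congr 1
    ext i j : 2
    simp [y, Matrix.vandermonde_apply]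
  have hanti {κ : Type} [Fintype κ] [DecidableEq κ] (f : κ → R) (e : ℕ) :
      PowerSeries.coeff e (∏ p, PowerSeries.mk fun m => f p ^ m)
        = ∑ m ∈ piAntidiag univ e, ∏ p, f p ^ m p := by
    rw [PowerSeries.coeff_prod]
    refine sum_bij' (fun l _ => l) (fun m _ => Finsupp.equivFunOnFinite.symm m) ?_ ?_ ?_ ?_ ?_
    · intro l hl; simpa using (mem_finsuppAntidiag.1 hl).1
    · intro m hm; simpa [mem_finsuppAntidiag] using hm
    · intro l _; ext; simp
    · intro m _; ext; simp
    · intro l _; simp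
  have hc := congrArg (PowerSeries.coeff (n + ∑ i : Fin M, (i : ℕ))) h
  rw [hVx, hVy, mul_assoc, mul_assoc, PowerSeries.coeff_X_pow_mul, ← mul_assoc, ← map_mul,
    PowerSeries.coeff_C_mul, hanti fun p : Fin M × Fin M => X p.1 * C (X p.2)] at hc
  rw [← hc, Matrix.det_apply, map_sum]
  refine Finset.sum_congr rfl fun σ _ => ?_
  simp only [Matrix.of_apply, Units.smul_def, map_zsmul]
  rw [hanti fun i : Fin M => X (σ i) * C (X i)]

theorem sum_alternantCoeff_mul_aux {M : ℕ} (n : ℕ) (β γ : Fin M → ℕ) (hβ : StrictAnti β)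
    (hγ : StrictAnti γ) :
    ∑ m ∈ piAntidiag univ n, alternantCoeff (fun i : Fin M => (i : ℕ)) β (fun i => ∑ j, m (i, j)) *
        alternantCoeff (fun i : Fin M => (i : ℕ)) γ (fun j => ∑ i, m (i, j))
      = if β = γ ∧ ∑ i, γ i = n + ∑ i : Fin M, (i : ℕ) then 1 else 0 := by
  have h := congrArg (fun q => coeff (Finsupp.equivFunOnFinite.symm γ)
    (coeff (Finsupp.equivFunOnFinite.symm β) q)) (cauchy_identity_coeff M n)
  simp only [mul_sum, smul_sum, coeff_sum] at h
  have hR (m : Fin M × Fin M → ℕ) : coeff (Finsupp.equivFunOnFinite.symm γ)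
    (coeff (Finsupp.equivFunOnFinite.symm β)
      ((Matrix.vandermonde fun i => (X i : MvPolynomial (Fin M) (MvPolynomial (Fin M) ℤ))).det *
        C (Matrix.vandermonde fun i => (X i : MvPolynomial (Fin M) ℤ)).det *
      ∏ p : Fin M × Fin M,
        (X p.1 * C (X p.2) : MvPolynomial (Fin M) (MvPolynomial (Fin M) ℤ)) ^ m p))
      = alternantCoeff (fun i : Fin M => (i : ℕ)) β (fun i => ∑ j, m (i, j)) *
        alternantCoeff (fun i : Fin M => (i : ℕ)) γ (fun j => ∑ i, m (i, j)) := by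
    have e1 : ∏ p : Fin M × Fin M,
        (X p.1 * C (X p.2) : MvPolynomial (Fin M) (MvPolynomial (Fin M) ℤ)) ^ m p
        = (∏ i, X i ^ (∑ j, m (i, j))) * C (∏ j, X j ^ ∑ i, m (i, j)) := by
      simp only [mul_pow, prod_mul_distrib]
      rw [Fintype.prod_prod_type, Fintype.prod_prod_type_right]
      simp [prod_pow_eq_pow_sum]
    rw [e1, mul_mul_mul_comm, ← map_mul, mul_comm, coeff_C_mul, mul_comm]
    have e2 := coeff_det_mul_prod (A := MvPolynomial (Fin M) ℤ) (fun i : Fin M => (i : ℕ)) β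
      (fun i => ∑ j, m (i, j))
    have e3 := coeff_det_mul_prod (A := ℤ) (fun i : Fin M => (i : ℕ)) γ
      (fun j => ∑ i, m (i, j))
    rw [Matrix.vandermonde, e2, ← map_intCast (C : ℤ →+* MvPolynomial (Fin M) ℤ), coeff_C_mul,
      Matrix.vandermonde, e3]
    simp
  have hL (σ : Equiv.Perm (Fin M)) (l : Fin M → ℕ) : coeff (Finsupp.equivFunOnFinite.symm γ)
    (coeff (Finsupp.equivFunOnFinite.symm β) ((Equiv.Perm.sign σ : ℤ) •
      ∏ i, (X (σ i) * C (X i) : MvPolynomial (Fin M) (MvPolynomial (Fin M) ℤ)) ^ l i))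
      = if β = γ ∧ σ = 1 ∧ l = γ then 1 else 0 := by
    have e1 : ∏ i, (X (σ i) * C (X i) : MvPolynomial (Fin M) (MvPolynomial (Fin M) ℤ)) ^ l i
        = (∏ i, X (σ i) ^ l i) * C (∏ i, X i ^ l i) := by
      simp [mul_pow, prod_mul_distrib]
    have e4 : coeff (Finsupp.equivFunOnFinite.symm γ) (∏ i, (X i : MvPolynomial (Fin M) ℤ) ^ l i)
        = if ∀ i, l i = γ i then 1 else 0 := by
      rw [prod_X_pow_eq, coeff_monomial]
      exact if_congr ((Equiv.apply_eq_iff_eq _).trans funext_iff) rfl rfl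
    rw [coeff_smul, coeff_smul, e1, mul_comm, coeff_C_mul, mul_comm, coeff_prod_X_pow_perm,
      ite_mul, one_mul,
      zero_mul, apply_ite (coeff _), e4, coeff_zero, ← ite_and]
    by_cases hl : l = γ
    · subst hl
      by_cases hb : β = l
      · subst hb
        by_cases hs : σ = 1
        · simp [hs]
        · rw [if_neg, smul_zero, if_neg (by simp [hs])]
          rintro ⟨h1, -⟩
          exact hs (Equiv.ext fun i => hβ.injective (h1 i).symm)
      · rw [if_neg, smul_zero, if_neg (by simp [hb])]
        rintro ⟨h1, -⟩
        refine hb ((hβ.range_inj hγ).1 (Eq.trans ?_ (congrArg Set.range (funext h1).symm)))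
        exact (σ.surjective.range_comp β).symm
    · rw [if_neg (fun h => hl (funext h.2)), smul_zero, if_neg (by simp [hl])]
  simp only [hR, hL] at h
  rw [← h]
  by_cases hb : β = γ
  · simp only [hb, true_and, ite_and, sum_ite_irrel]
    simp
  · simp [hb]

theorem sum_alternantCoeff_mul {M : ℕ} (n : ℕ) (β γ : Fin M → ℕ) (hβ : StrictAnti β)
    (hγ : StrictAnti γ) :
    ∑ m ∈ piAntidiag univ n,
        alternantCoeff (fun i : Fin M => M - 1 - (i : ℕ)) β (fun i => ∑ j, m (i, j)) *
        alternantCoeff (fun i : Fin M => M - 1 - (i : ℕ)) γ (fun j => ∑ i, m (i, j))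
      = if β = γ ∧ ∑ i, γ i = n + ∑ i : Fin M, (i : ℕ) then 1 else 0 := by
  rw [← sum_alternantCoeff_mul_aux n β γ hβ hγ]
  refine Finset.sum_congr rfl fun m _ => ?_
  rw [show (fun i : Fin M => M - 1 - (i : ℕ)) = (fun i : Fin M => (i : ℕ)) ∘ Fin.revPerm from
    funext fun i => by simp; omega, alternantCoeff_perm, alternantCoeff_perm, mul_mul_mul_comm,
    ← Units.val_mul, Int.units_mul_self, Units.val_one, one_mul]

end Orthogonality

section Positivity

variable {M : ℕ}

theorem strictAnti_staircase : StrictAnti fun i : Fin M => M - 1 - (i : ℕ) := by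
  intro i j h
  have := j.isLt
  simp only [Fin.lt_def] at h ⊢
  omega

theorem sum_staircase : ∑ i : Fin M, (M - 1 - (i : ℕ)) = ∑ i : Fin M, (i : ℕ) := by
  rw [← Equiv.sum_comp Fin.revPerm]
  refine Finset.sum_congr rfl fun i _ => ?_
  simp
  omega

theorem coeff_alternant_mul_eq_zero (δ β : Fin M → ℕ) (n : ℕ) {a b : Fin M} (hab : a ≠ b)
    (h : β a = β b) :
    coeff (Finsupp.equivFunOnFinite.symm β)
      ((Matrix.of fun i j => (X i : MvPolynomial (Fin M) ℤ) ^ δ j).det * (∑ i, X i) ^ n) = 0 := by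
  set P := (Matrix.of fun i j => (X i : MvPolynomial (Fin M) ℤ) ^ δ j).det * (∑ i, X i) ^ n
  have hP : rename (Equiv.swap a b) P = -P := by
    have hV := Matrix.det_permute (Equiv.swap a b)
      (Matrix.of fun i j => (X i : MvPolynomial (Fin M) ℤ) ^ δ j)
    rw [Equiv.Perm.sign_swap hab] at hV
    have e1 : rename (Equiv.swap a b) (Matrix.of fun i j =>
        (X i : MvPolynomial (Fin M) ℤ) ^ δ j).det = -(Matrix.of fun i j =>
        (X i : MvPolynomial (Fin M) ℤ) ^ δ j).det := by
      rw [AlgHom.map_det]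
      refine Eq.trans (congrArg Matrix.det ?_) (hV.trans (by simp))
      ext i j : 2
      simp
    have e2 : rename (Equiv.swap a b) (∑ i, (X i : MvPolynomial (Fin M) ℤ)) = ∑ i, X i := by
      rw [map_sum]
      simp only [rename_X]
      exact Equiv.sum_comp _ _
    rw [map_mul, map_pow, e1, e2, neg_mul]
  have h1 := coeff_rename_mapDomain (Equiv.swap a b) (Equiv.injective _) P
    (Finsupp.equivFunOnFinite.symm β)
  have h2 : (Finsupp.equivFunOnFinite.symm β).mapDomain (Equiv.swap a b)
      = Finsupp.equivFunOnFinite.symm β := by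
    ext i
    rw [← Equiv.swap_apply_self a b i, Finsupp.mapDomain_apply (Equiv.injective _)]
    simp only [Finsupp.equivFunOnFinite_symm_apply_apply, Equiv.swap_apply_self]
    rcases eq_or_ne i a with rfl | hia
    · simp [h]
    · rcases eq_or_ne i b with rfl | hib
      · simp [h]
      · rw [Equiv.swap_apply_of_ne_of_ne hia hib]
  rw [h2, hP, coeff_neg] at h1
  omega

theorem alternantCoeff_self_zero {δ : Fin M → ℕ} (hδ : Function.Injective δ) :
    alternantCoeff δ δ 0 = 1 := by
  rw [alternantCoeff, ← Matrix.det_one (n := Fin M)]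
  congr 1
  ext i j
  simp [Matrix.one_apply, hδ.eq_iff, eq_comm]

theorem coeff_alternant_mul_nonneg {δ : Fin M → ℕ} (hδ : StrictAnti δ) (n : ℕ) (β : Fin M → ℕ)
    (hβ : Antitone β) :
    0 ≤ coeff (Finsupp.equivFunOnFinite.symm β)
      ((Matrix.of fun i j => (X i : MvPolynomial (Fin M) ℤ) ^ δ j).det * (∑ i, X i) ^ n) := by
  induction n generalizing β with
  | zero =>
    by_cases h : Function.Injective β
    · have hc := coeff_det_mul_prod (A := ℤ) δ β 0
      simp only [Pi.zero_apply, pow_zero, prod_const_one] at hc ⊢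
      rw [hc, Int.cast_id]
      by_cases hb : δ = β
      · rw [← hb, alternantCoeff_self_zero hδ.injective]
        exact zero_le_one
      · rw [alternantCoeff, Matrix.det_apply]
        refine (Finset.sum_eq_zero fun σ _ => ?_).ge
        rw [Finset.prod_eq_zero_iff.2, smul_zero]
        by_contra! hne
        have hs : ∀ i, δ i = β (σ i) := fun i => by simpa using hne i (mem_univ _)
        refine hb ((hδ.range_inj (hβ.strictAnti_of_injective h)).1 ?_)
        rw [funext hs]
        exact σ.surjective.range_comp β
    · simp only [Function.Injective, not_forall] at h
      obtain ⟨a, b, hab, hne⟩ := h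
      rw [coeff_alternant_mul_eq_zero δ β 0 hne hab]
  | succ n ih =>
    by_cases h : Function.Injective β
    · rw [pow_succ, ← mul_assoc, mul_sum, coeff_sum]
      refine sum_nonneg fun i _ => ?_
      rw [coeff_mul_X']
      split_ifs with hi
      · have : (Finsupp.equivFunOnFinite.symm β - Finsupp.single i 1 : Fin M →₀ ℕ)
            = Finsupp.equivFunOnFinite.symm fun j => β j - if i = j then 1 else 0 := by
          ext j
          simp [Finsupp.single_apply]
        rw [this]
        refine ih _ fun j k hjk => ?_
        rcases hjk.eq_or_lt with rfl | hlt
        · rfl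
        · have := hβ.strictAnti_of_injective h hlt
          split_ifs <;> omega
      · rfl
    · simp only [Function.Injective, not_forall] at h
      obtain ⟨a, b, hab, hne⟩ := h
      rw [coeff_alternant_mul_eq_zero δ β _ hne hab]

variable {Y : Type} [Fintype Y] [DecidableEq Y]

theorem prod_X_comp_eq {ι : Type} [Fintype ι] [DecidableEq ι] {A : Type*} [CommRing A]
    (f : Y → ι) : ∏ y, (X (f y) : MvPolynomial ι A) = ∏ i, X i ^ content f i := by
  rw [← Finset.prod_fiberwise univ f]
  refine Finset.prod_congr rfl fun i _ => ?_
  rw [Finset.prod_congr rfl (g := fun _ => X i) (fun y hy => by rw [(mem_filter.1 hy).2]),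
    Finset.prod_const]
  rfl

theorem colorSum_alternantCoeff_one_nonneg {δ β : Fin M → ℕ} (hδ : StrictAnti δ)
    (hβ : StrictAnti β) : 0 ≤ colorSum (alternantCoeff δ β) (1 : Equiv.Perm Y) := by
  have h := coeff_alternant_mul_nonneg hδ (Fintype.card Y) β hβ.antitone
  rw [← Finset.card_univ, ← Finset.prod_const, Finset.prod_univ_sum, mul_sum, coeff_sum] at h
  simp only [Fintype.piFinset_univ, prod_X_comp_eq, coeff_det_mul_prod, Int.cast_id] at h
  simpa [colorSum] using h

theorem charInner_colorSum_alternantCoeff {β γ : Fin M → ℕ} (hβ : StrictAnti β)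
    (hγ : StrictAnti γ) :
    charInner (fun g : Equiv.Perm Y =>
        (colorSum (alternantCoeff (fun i : Fin M => M - 1 - (i : ℕ)) β) g : ℚ))
      (fun g => (colorSum (alternantCoeff (fun i : Fin M => M - 1 - (i : ℕ)) γ) g : ℚ))
      = if β = γ ∧ ∑ i, γ i = Fintype.card Y + ∑ i : Fin M, (i : ℕ) then 1 else 0 := by
  simp only [charInner, colorSum_inv]
  have h := congrArg (Int.cast : ℤ → ℚ) (sum_colorSum_mul_colorSum (Y := Y)
    (alternantCoeff (fun i : Fin M => M - 1 - (i : ℕ)) β)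
    (alternantCoeff (fun i : Fin M => M - 1 - (i : ℕ)) γ))
  rw [sum_alternantCoeff_mul _ _ _ hβ hγ] at h
  push_cast at h
  rw [h, Nat.card_eq_fintype_card, Fintype.card_perm,
    inv_mul_cancel_left₀ (Nat.cast_ne_zero.2 (Nat.factorial_ne_zero _))]

/-- The class function attached to a strictly decreasing sequence of exponents by the
Frobenius formula is a character. -/
theorem isCharacter_colorSum_alternantCoeff {β : Fin M → ℕ} (hβ : StrictAnti β) :
    IsCharacter fun g : Equiv.Perm Y =>
      (colorSum (alternantCoeff (fun i : Fin M => M - 1 - (i : ℕ)) β) g : ℚ) := by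
  refine (isVirtualCharacter_colorSum _).isCharacter_of_charInner_self_le_one ?_ ?_
  · rw [charInner_colorSum_alternantCoeff hβ hβ]
    split_ifs <;> norm_num
  · exact_mod_cast colorSum_alternantCoeff_one_nonneg strictAnti_staircase hβ

end Positivity

section CycleType

variable {Y ι : Type} [Fintype Y] [DecidableEq Y] [Fintype ι] [DecidableEq ι]

theorem prod_orbits_sum_pow {A : Type*} [CommRing A] (g : Equiv.Perm Y) (x : ι → A)
    [Fintype (Quotient (Equiv.Perm.SameCycle.setoid g))]
    [DecidableEq (Quotient (Equiv.Perm.SameCycle.setoid g))] :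
    ∏ q : Quotient (Equiv.Perm.SameCycle.setoid g), ∑ i, x i ^ #{y : Y | Quotient.mk _ y = q}
      = ∑ f : Y → ι with f ∘ g = f, ∏ y, x (f y) := by
  rw [Finset.prod_univ_sum]
  simp only [Fintype.piFinset_univ]
  have hlift (f : Y → ι) (hf : f ∘ g = f) (a b : Y) (hab : Equiv.Perm.SameCycle g a b) :
      f a = f b := by
    obtain ⟨k, rfl⟩ := hab
    induction k using Int.induction_on generalizing a with
    | zero => rfl
    | succ k ih =>
      rw [zpow_add_one, Equiv.Perm.mul_apply, ← ih]
      exact (congrFun hf a).symm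
    | pred k ih =>
      rw [zpow_sub_one, Equiv.Perm.mul_apply, ← ih]
      exact (congrFun ((comp_inv_eq_iff f g).2 hf) a).symm
  refine sum_bij' (fun F _ y => F (Quotient.mk _ y))
    (fun f hf => fun q => Quotient.lift f (hlift f (mem_filter.1 hf).2) q) ?_ ?_ ?_ ?_ ?_
  · intro F _
    simp only [mem_filter, mem_univ, true_and]
    funext y
    refine congrArg F (Quotient.sound ?_)
    exact ⟨-1, by simp⟩
  · intro f _; exact mem_univ _
  · intro F _
    funext q
    induction q using Quotient.inductionOn
    rfl
  · intro f _; rfl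
  · intro F _
    rw [← Finset.prod_fiberwise univ
      (fun y => (Quotient.mk _ y : Quotient (Equiv.Perm.SameCycle.setoid g)))]
    refine Finset.prod_congr rfl fun q _ => ?_
    rw [Finset.prod_congr rfl (g := fun _ => x (F q))
      (fun y hy => congrArg (fun q => x (F q)) (mem_filter.1 hy).2), Finset.prod_const]

open Classical in
/-- The partition given by the sizes of the orbits of a permutation. -/
noncomputable def orbitPartition {n : ℕ} (g : Equiv.Perm (Fin n)) : Nat.Partition n where
  parts := (univ : Finset (Quotient (Equiv.Perm.SameCycle.setoid g))).val.map
    fun q => #{y : Fin n | Quotient.mk _ y = q}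
  parts_pos := by
    intro i hi
    obtain ⟨q, -, rfl⟩ := Multiset.mem_map.1 hi
    obtain ⟨y, rfl⟩ := Quotient.exists_rep q
    exact card_pos.2 ⟨y, by simp⟩
  parts_sum := by
    change ∑ q : Quotient (Equiv.Perm.SameCycle.setoid g), _ = n
    rw [← card_eq_sum_card_fiberwise (by simp), card_univ, Fintype.card_fin]

theorem prod_orbitPartition_sum_pow {A : Type*} [CommRing A] {n : ℕ} (g : Equiv.Perm (Fin n))
    (x : ι → A) : ((orbitPartition g).parts.map fun p => ∑ i, x i ^ p).prod
      = ∑ f : Fin n → ι with f ∘ g = f, ∏ y, x (f y) := by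
  classical
  rw [← prod_orbits_sum_pow, orbitPartition, Multiset.map_map]
  simp only [Finset.prod, Function.comp_apply]

theorem pprod_orbitPartition (N : ℕ) {n : ℕ} (g : Equiv.Perm (Fin n)) :
    pprod N (orbitPartition g) = ∑ f : Fin n → Fin N with f ∘ g = f, ∏ y, X (f y) :=
  prod_orbitPartition_sum_pow g X

theorem vandermonde_eq_det (N : ℕ) :
    vandermonde N = (Matrix.of fun i j : Fin N => (X i : MvPolynomial (Fin N) ℤ) ^
      (N - 1 - (j : ℕ))).det := by
  rw [← Matrix.det_submatrix_equiv_self Fin.revPerm]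
  have h : (Matrix.of fun i j : Fin N => (X i : MvPolynomial (Fin N) ℤ) ^
      (N - 1 - (j : ℕ))).submatrix Fin.revPerm Fin.revPerm
      = Matrix.vandermonde fun i => X (Fin.rev i) := by
    ext i j : 2
    simp only [Matrix.submatrix_apply, Matrix.of_apply, Matrix.vandermonde_apply,
      Fin.revPerm_apply, Fin.val_rev]
    rw [show N - 1 - (N - ((j : ℕ) + 1)) = j by omega]
  rw [h, Matrix.det_vandermonde, Finset.prod_sigma', vandermonde]
  refine prod_bij' (fun p _ => ⟨Fin.rev p.2, Fin.rev p.1⟩)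
    (fun p _ => (Fin.rev p.2, Fin.rev p.1)) ?_ ?_ ?_ ?_ ?_ <;> simp

/-- The exponents in the Frobenius formula in `M` variables. -/
noncomputable def frobeniusExponent (M : ℕ) {n : ℕ} (l : Nat.Partition n) (i : Fin M) : ℕ :=
  (l.parts.sort (· ≥ ·)).getD i 0 + (M - 1 - (i : ℕ))

theorem antitone_getD_sort (s : Multiset ℕ) : Antitone fun i : ℕ => (s.sort (· ≥ ·)).getD i 0 := by
  intro i j hij
  dsimp only
  by_cases hj : j < (s.sort (· ≥ ·)).length
  · rw [List.getD_eq_getElem _ _ hj, List.getD_eq_getElem _ _ (hij.trans_lt hj)]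
    exact (Multiset.pairwise_sort s (· ≥ ·)).rel_get_of_le (a := ⟨i, hij.trans_lt hj⟩)
      (b := ⟨j, hj⟩) hij
  · rw [List.getD_eq_default _ _ (not_lt.1 hj)]
    exact Nat.zero_le _

theorem strictAnti_frobeniusExponent (M : ℕ) {n : ℕ} (l : Nat.Partition n) :
    StrictAnti (frobeniusExponent M l) := fun _ _ h =>
  add_lt_add_of_le_of_lt (antitone_getD_sort _ h.le) (strictAnti_staircase h)

theorem length_sort_parts_le {n : ℕ} (l : Nat.Partition n) :
    (l.parts.sort (· ≥ ·)).length ≤ n := by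
  rw [Multiset.length_sort]
  calc l.parts.card = l.parts.card • 1 := by simp
    _ ≤ l.parts.sum := Multiset.card_nsmul_le_sum fun x hx => l.parts_pos hx
    _ = n := l.parts_sum

theorem sum_range_getD (L : List ℕ) {n : ℕ} (h : L.length ≤ n) :
    ∑ i ∈ range n, L.getD i 0 = L.sum := by
  induction L generalizing n with
  | nil => simp
  | cons a L ih =>
    obtain ⟨m, rfl⟩ := Nat.exists_eq_add_of_le' ((Nat.le_add_left 1 L.length).trans h)
    rw [sum_range_succ']
    simp only [List.getD_cons_succ, List.getD_cons_zero, List.sum_cons]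
    rw [ih (by simpa using h), add_comm]

theorem sum_frobeniusExponent {n : ℕ} (l : Nat.Partition n) :
    ∑ i, frobeniusExponent n l i = n + ∑ i : Fin n, (i : ℕ) := by
  simp only [frobeniusExponent, sum_add_distrib, sum_staircase]
  congr 1
  rw [Fin.sum_univ_eq_sum_range fun i => (l.parts.sort (· ≥ ·)).getD i 0]
  conv_rhs => rw [← l.parts_sum, ← Multiset.sort_eq l.parts (· ≥ ·), Multiset.sum_coe]
  exact sum_range_getD _ (length_sort_parts_le l)

theorem frobeniusExponent_injective (n : ℕ) :
    Function.Injective (frobeniusExponent n : Nat.Partition n → _) := by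
  intro l l' h
  have hg (i : ℕ) : (l.parts.sort (· ≥ ·)).getD i 0 = (l'.parts.sort (· ≥ ·)).getD i 0 := by
    by_cases hi : i < n
    · simpa [frobeniusExponent] using congrFun h ⟨i, hi⟩
    · rw [List.getD_eq_default _ _ ((length_sort_parts_le l).trans (not_lt.1 hi)),
        List.getD_eq_default _ _ ((length_sort_parts_le l').trans (not_lt.1 hi))]
  have hopt (l : Nat.Partition n) (i : ℕ) : (l.parts.sort (· ≥ ·))[i]?
      = if (l.parts.sort (· ≥ ·)).getD i 0 = 0 then none
        else some ((l.parts.sort (· ≥ ·)).getD i 0) := by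
    by_cases hi : i < (l.parts.sort (· ≥ ·)).length
    · rw [List.getD_eq_getElem _ _ hi, List.getElem?_eq_getElem hi, if_neg]
      exact (l.parts_pos ((Multiset.mem_sort (· ≥ ·)).1 (List.getElem_mem hi))).ne'
    · rw [List.getD_eq_default _ _ (not_lt.1 hi), List.getElem?_eq_none (not_lt.1 hi), if_pos rfl]
  have hl : l.parts.sort (· ≥ ·) = l'.parts.sort (· ≥ ·) :=
    List.ext_getElem? fun i => by rw [hopt, hopt, hg]
  refine Nat.Partition.ext ?_
  rw [← Multiset.sort_eq l.parts (· ≥ ·), hl, Multiset.sort_eq]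

theorem chi_orbitPartition {n : ℕ} (l : Nat.Partition n) (g : Equiv.Perm (Fin n)) :
    chi l (orbitPartition g) =
      colorSum (alternantCoeff (fun i : Fin n => n - 1 - (i : ℕ)) (frobeniusExponent n l)) g := by
  rw [chi, pprod_orbitPartition, vandermonde_eq_det, mul_sum, coeff_sum, colorSum]
  refine Finset.sum_congr rfl fun f _ => ?_
  rw [prod_X_comp_eq]
  exact (coeff_det_mul_prod (A := ℤ) _ _ _).trans (Int.cast_id)

end CycleType

section Boxplus

theorem getD_flatMap_replicate (d : ℕ) (L : List ℕ) (a r : ℕ) (hr : r < d) :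
    (L.flatMap fun p => List.replicate d (d * p)).getD (d * a + r) 0 = d * L.getD a 0 := by
  induction L generalizing a with
  | nil => simp
  | cons p L ih =>
    rw [List.flatMap_cons]
    cases a with
    | zero =>
      rw [List.getD_append _ _ _ _ (by simpa using hr), List.getD_replicate _ (by simpa using hr)]
      simp
    | succ a =>
      rw [List.getD_append_right _ _ _ _ (by simp [mul_add]; omega)]
      simp only [List.length_replicate, List.getD_cons_succ]
      rw [← ih, show d * (a + 1) + r - d = d * a + r by rw [mul_add]; omega]

theorem sort_parts_boxplus (d : ℕ) {n : ℕ} (l : Nat.Partition n) :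
    (boxplus d l).parts.sort (· ≥ ·)
      = (l.parts.sort (· ≥ ·)).flatMap fun p => List.replicate d (d * p) := by
  refine List.Perm.eq_of_pairwise' (r := (· ≥ ·)) (Multiset.pairwise_sort _ _) ?_ ?_
  · rw [List.pairwise_flatMap]
    refine ⟨fun p _ => List.pairwise_replicate.2 (Or.inr le_rfl), ?_⟩
    refine (Multiset.pairwise_sort l.parts (· ≥ ·)).imp fun {p q} hpq x hx y hy => ?_
    rw [List.eq_of_mem_replicate hx, List.eq_of_mem_replicate hy]
    exact Nat.mul_le_mul_left d hpq
  · rw [← Multiset.coe_eq_coe, Multiset.sort_eq, ← Multiset.coe_bind, Multiset.sort_eq]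
    rfl

/-- Splitting `Fin (d * m)` into `m` consecutive blocks of length `d`. -/
def blockEquiv (d m : ℕ) : Fin m × Fin d ≃ Fin (d * m) :=
  finProdFinEquiv.trans (finCongr (mul_comm m d))

theorem val_blockEquiv (d m : ℕ) (p : Fin m × Fin d) :
    (blockEquiv d m p : ℕ) = d * p.1 + p.2 := by
  simp [blockEquiv, finProdFinEquiv, add_comm]

theorem staircase_blockEquiv (d m : ℕ) (p : Fin m × Fin d) :
    d * m - 1 - (blockEquiv d m p : ℕ) = d * (m - 1 - p.1) + (d - 1 - p.2) := by
  rw [val_blockEquiv]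
  obtain ⟨⟨a, ha⟩, ⟨r, hr⟩⟩ := p
  obtain ⟨k, rfl⟩ := Nat.exists_eq_add_of_lt ha
  simp only
  rw [show a + k + 1 - 1 - a = k by omega, mul_add, mul_add]
  omega

theorem frobeniusExponent_boxplus (d m : ℕ) {n : ℕ} (l : Nat.Partition n) (p : Fin m × Fin d) :
    frobeniusExponent (d * m) (boxplus d l) (blockEquiv d m p)
      = d * frobeniusExponent m l p.1 + (d - 1 - p.2) := by
  rw [frobeniusExponent, staircase_blockEquiv, val_blockEquiv, sort_parts_boxplus,
    getD_flatMap_replicate _ _ _ _ p.2.isLt, frobeniusExponent]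
  ring

variable {Y ι κ : Type} [Fintype Y] [DecidableEq Y] [Fintype ι] [DecidableEq ι]
  [Fintype κ] [DecidableEq κ]

theorem alternantCoeff_comp_equiv (e : κ ≃ ι) (δ β c : ι → ℕ) :
    alternantCoeff (δ ∘ e) (β ∘ e) (c ∘ e) = alternantCoeff δ β c :=
  Matrix.det_submatrix_equiv_self e
    (Matrix.of fun i j => if c i + δ j = β i then (1 : ℤ) else 0)

theorem colorSum_comp_equiv (e : κ ≃ ι) (k : (κ → ℕ) → ℤ) (g : Equiv.Perm Y) :
    colorSum (fun c : ι → ℕ => k (c ∘ e)) g = colorSum k g := by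
  refine sum_bij' (fun f _ => e.symm ∘ f) (fun f _ => e ∘ f) ?_ ?_ ?_ ?_ ?_
  · intro f hf
    simp only [mem_filter, mem_univ, true_and] at hf ⊢
    rw [Function.comp_assoc, hf]
  · intro f hf
    simp only [mem_filter, mem_univ, true_and] at hf ⊢
    rw [Function.comp_assoc, hf]
  · intro f _; funext y; simp
  · intro f _; funext y; simp
  · intro f _
    refine congrArg k (funext fun i => ?_)
    simp [content, Equiv.symm_apply_eq]

theorem alternantCoeff_blocks (d m : ℕ) {n : ℕ} (l : Nat.Partition n)
    (c : Fin m × Fin d → ℕ) :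
    alternantCoeff ((fun i : Fin (d * m) => d * m - 1 - (i : ℕ)) ∘ blockEquiv d m)
        (frobeniusExponent (d * m) (boxplus d l) ∘ blockEquiv d m) (fun p => d * c p)
      = ∏ r, alternantCoeff (fun i : Fin m => m - 1 - (i : ℕ)) (frobeniusExponent m l)
          (fun a => c (a, r)) := by
  simp only [alternantCoeff]
  rw [← Matrix.det_blockDiagonal]
  congr 1
  ext ⟨a, r⟩ ⟨b, s⟩
  rw [Matrix.blockDiagonal_apply]
  simp only [Matrix.of_apply, Function.comp_apply, staircase_blockEquiv, frobeniusExponent_boxplus]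
  rw [← ite_and]
  refine if_congr ?_ rfl rfl
  have hr := r.isLt
  have hs := s.isLt
  have hd : 0 < d := by omega
  rw [← add_assoc, ← mul_add]
  constructor
  · intro h
    have h1 := congrArg (· % d) h
    have h2 := congrArg (· / d) h
    simp only [Nat.mul_add_mod, Nat.mul_add_div hd,
      Nat.mod_eq_of_lt (show d - 1 - (s : ℕ) < d by omega),
      Nat.mod_eq_of_lt (show d - 1 - (r : ℕ) < d by omega),
      Nat.div_eq_of_lt (show d - 1 - (s : ℕ) < d by omega),
      Nat.div_eq_of_lt (show d - 1 - (r : ℕ) < d by omega)] at h1 h2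
    exact ⟨Fin.ext (by omega), h2⟩
  · rintro ⟨rfl, h⟩
    rw [h]

/-- The action of a permutation on `d` copies of its domain. -/
def copiesHom (Y κ : Type) : Equiv.Perm Y →* Equiv.Perm (Y × κ) where
  toFun g := g.prodCongr (Equiv.refl κ)
  map_one' := rfl
  map_mul' _ _ := rfl

theorem pow_sum_invariant {A : Type*} [CommRing A] (d : ℕ) (g : Equiv.Perm Y) (x : ι → A) :
    (∑ f : Y → ι with f ∘ g = f, ∏ y, x (f y)) ^ d
      = ∑ F : Y × Fin d → ι with F ∘ copiesHom Y (Fin d) g = F, ∏ z, x (F z) := by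
  rw [← Fin.prod_const, Finset.prod_univ_sum]
  refine sum_bij' (fun F _ z => F z.2 z.1) (fun F _ r y => F (y, r)) ?_ ?_ ?_ ?_ ?_
  · intro F hF
    simp only [mem_filter, mem_univ, true_and, Fintype.mem_piFinset] at hF ⊢
    funext z
    exact congrFun (hF z.2) z.1
  · intro F hF
    simp only [mem_filter, mem_univ, true_and, Fintype.mem_piFinset] at hF ⊢
    intro r
    funext y
    exact congrFun hF (y, r)
  · intro _ _; rfl
  · intro _ _; rfl
  · intro F _
    rw [Fintype.prod_prod_type_right]

theorem pprod_boxplus_orbitPartition (N d : ℕ) {n : ℕ} (g : Equiv.Perm (Fin n)) :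
    pprod N (boxplus d (orbitPartition g))
      = ∑ F : Fin n × Fin d → Fin N with F ∘ copiesHom (Fin n) (Fin d) g = F, ∏ z, X (F z) ^ d := by
  rw [← pow_sum_invariant d g fun i => (X i : MvPolynomial (Fin N) ℤ) ^ d,
    ← prod_orbitPartition_sum_pow g fun i => (X i : MvPolynomial (Fin N) ℤ) ^ d, pprod, boxplus,
    Multiset.map_bind, Multiset.prod_bind]
  simp only [Multiset.map_replicate, Multiset.prod_replicate, Multiset.prod_map_pow,
    _root_.psum, pow_mul]

theorem chi_boxplus_orbitPartition (d : ℕ) {n : ℕ} (l : Nat.Partition n)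
    (g : Equiv.Perm (Fin n)) :
    chi (boxplus d l) (boxplus d (orbitPartition g))
      = colorSum (fun c : Fin (d * n) × Fin d → ℕ =>
        ∏ r, alternantCoeff (fun i : Fin (d * n) => d * n - 1 - (i : ℕ))
          (frobeniusExponent (d * n) l) fun a => c (a, r)) (copiesHom (Fin n) (Fin d) g) := by
  rw [← colorSum_comp_equiv (blockEquiv d (d * n))]
  simp only [← alternantCoeff_blocks]
  rw [chi, pprod_boxplus_orbitPartition, vandermonde_eq_det, mul_sum, coeff_sum, colorSum]
  refine Finset.sum_congr rfl fun F _ => ?_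
  rw [prod_pow, prod_X_comp_eq, ← prod_pow]
  simp only [← pow_mul, mul_comm _ d]
  refine (coeff_det_mul_prod (A := ℤ) _ (frobeniusExponent _ (boxplus d l)) _).trans ?_
  rw [Int.cast_id, ← alternantCoeff_comp_equiv (blockEquiv d (d * n))]
  rfl

theorem isCharacter_chi_boxplus (d : ℕ) {n : ℕ} (l : Nat.Partition n) :
    IsCharacter fun g : Equiv.Perm (Fin n) =>
      (chi (boxplus d l) (boxplus d (orbitPartition g)) : ℚ) := by
  simp only [chi_boxplus_orbitPartition]
  exact (isCharacter_colorSum_prod _ fun Z _ _ =>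
    isCharacter_colorSum_alternantCoeff (strictAnti_frobeniusExponent _ l)).comp
      (copiesHom (Fin n) (Fin d))

theorem isCharacter_chi {n : ℕ} (l : Nat.Partition n) :
    IsCharacter fun g : Equiv.Perm (Fin n) => (chi l (orbitPartition g) : ℚ) := by
  simp only [chi_orbitPartition]
  exact isCharacter_colorSum_alternantCoeff (strictAnti_frobeniusExponent _ l)

theorem charInner_chi {n : ℕ} (l l' : Nat.Partition n) :
    charInner (fun g : Equiv.Perm (Fin n) => (chi l (orbitPartition g) : ℚ))
      (fun g => (chi l' (orbitPartition g) : ℚ)) = if l = l' then 1 else 0 := by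
  simp only [chi_orbitPartition]
  rw [charInner_colorSum_alternantCoeff (strictAnti_frobeniusExponent _ l)
    (strictAnti_frobeniusExponent _ l')]
  simp [sum_frobeniusExponent, (frobeniusExponent_injective n).eq_iff]

/-- Any function on partitions is expanded in the values `chi` by taking scalar products. -/
theorem eq_sum_charInner_mul_chi {n : ℕ} (f : Nat.Partition n → ℚ) (mu : Nat.Partition n) :
    f mu = ∑ nu, charInner (fun g : Equiv.Perm (Fin n) => f (orbitPartition g))
      (fun g => (chi nu (orbitPartition g) : ℚ)) * chi nu mu := by
  let A : Matrix (Nat.Partition n) (Nat.Partition n) ℚ := Matrix.of fun nu mu => (chi nu mu : ℚ)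
  let w (mu : Nat.Partition n) : ℚ :=
    (Nat.card (Equiv.Perm (Fin n)) : ℚ)⁻¹ * #{g : Equiv.Perm (Fin n) | orbitPartition g = mu}
  have hinner (f : Nat.Partition n → ℚ) (nu : Nat.Partition n) :
      charInner (fun g : Equiv.Perm (Fin n) => f (orbitPartition g))
        (fun g => (chi nu (orbitPartition g) : ℚ)) = ∑ mu, f mu * (w mu * A nu mu) := by
    simp only [charInner, chi_orbitPartition, colorSum_inv]
    simp only [← chi_orbitPartition]
    rw [← Finset.sum_fiberwise univ orbitPartition, mul_sum]
    refine Finset.sum_congr rfl fun mu _ => ?_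
    rw [Finset.sum_congr rfl (g := fun _ => f mu * (chi nu mu : ℚ))
      (fun g hg => by rw [(mem_filter.1 hg).2]), Finset.sum_const, nsmul_eq_mul]
    simp only [w, A, Matrix.of_apply]
    ring
  have hA : A * Matrix.of (fun mu nu => w mu * A nu mu) = 1 := by
    ext l l'
    rw [Matrix.mul_apply, Matrix.one_apply, ← charInner_chi l l']
    exact (hinner (fun mu => (chi l mu : ℚ)) l').symm
  have hA' := _root_.mul_eq_one_comm.1 hA
  have h := congrFun (congrArg (Matrix.vecMul f) hA') mu
  rw [Matrix.vecMul_one, ← Matrix.vecMul_vecMul] at h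
  rw [← h]
  simp only [hinner]
  rfl

end Boxplus

/-- **Miller's embedding problem** (Theorem 1): for `d ≥ 1` and `λ ⊢ n ≥ 1`, the class
function `μ ↦ χ^{⊞^d(λ)}_{⊞^d(μ)}` on `S_n` is a genuine character, i.e. a nonnegative
integer combination of the irreducible characters of `S_n`. -/
theorem boxplus_class_function_is_character (d n : ℕ) (hd : 1 ≤ d) (hn : 1 ≤ n)
    (lam : Nat.Partition n) :
    ∃ a : Nat.Partition n → ℕ,
      ∀ mu : Nat.Partition n,
        chi (boxplus d lam) (boxplus d mu) =
          ∑ nu : Nat.Partition n, (a nu : ℤ) * chi nu mu := by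
  choose a ha using fun nu : Nat.Partition n =>
    (isCharacter_chi_boxplus d lam).exists_charInner_eq_nat (isCharacter_chi nu)
  refine ⟨a, fun mu => ?_⟩
  have h := eq_sum_charInner_mul_chi (fun mu => (chi (boxplus d lam) (boxplus d mu) : ℚ)) mu
  simp only [ha] at h
  exact_mod_cast h
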